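/- Let Θ ⊆ Ω^∞ be a closed equal parity poset of marked compositions, d an integer of parity Θ, and k an integer such that the complex (ℤ[Θ_{d+2}], ∂_M^∞), graded by assigning x the degree d+2−|x|', has vanishing homology in all degrees ≥ k. Then for every j > k the truncation map trunc induces an isomorphism H_{j+2}(ℤ[Θ_{⟨d+2]}], ∂^∞) ≅ H_j(ℤ[Θ_{⟨d]}], ∂^∞). -/

import Mathlib

/-- A composition: a (possibly empty) list of positive integers. -/
abbrev Comp : Type := List PNat

/-- A marked composition: a composition together with a mark `κ : ℕ`. -/
abbrev MComp : Type := List PNat × ℕ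

/-- The norm `|ω|` of a composition. -/
def normC (ω : Comp) : ℕ := (ω.map fun a => (a : ℕ)).sum

/-- The reduced norm `|ω|' = |ω| - ℓ` of a composition. -/
def rnormC (ω : Comp) : ℕ := normC ω - ω.length

/-- The norm of a marked composition. -/
def normM (x : MComp) : ℕ := normC x.1 + x.2

/-- The reduced norm of a marked composition. -/
def rnormM (x : MComp) : ℕ := rnormC x.1 + x.2

/-- Merge the parts at (0-indexed) positions `k` and `k+1` of a composition. -/
def mergeAux : Comp → ℕ → Comp
  | a :: b :: t, 0 => (a + b) :: t
  | a :: t, n + 1 => a :: mergeAux t n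
  | l, _ => l

/-- The merge operation `M_k^∞` (`0 ≤ k ≤ ℓ`) on marked compositions:
`M_0^∞` moves the first part to the mark, `M_ℓ^∞` moves the last part to the mark, and
for `1 ≤ k ≤ ℓ-1`, `M_k^∞` merges the `k`-th and `(k+1)`-st parts (1-indexed). -/
def mergeM (x : MComp) (k : ℕ) : MComp :=
  if k = 0 then
    match x.1 with
    | [] => x
    | a :: t => (t, x.2 + (a : ℕ))
  else if k = x.1.length then
    match x.1.getLast? with
    | none => x
    | some a => (x.1.dropLast, x.2 + (a : ℕ))
  else (mergeAux x.1 (k - 1), x.2)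

/-- The insert operation `I_k` (`0 ≤ k ≤ ℓ`): insert a part `2` after the first `k` parts. -/
def insertC (ω : Comp) (k : ℕ) : Comp := ω.take k ++ (2 : PNat) :: ω.drop k

/-- The insert operation `I_k^∞` on marked compositions. -/
def insertM (x : MComp) (k : ℕ) : MComp := (insertC x.1 k, x.2)

/-- One merge or insert step on marked compositions: `mstep y x` means `x` is
obtained from `y` by a single operation. -/
def mstep (y x : MComp) : Prop :=
  (∃ k ≤ y.1.length, y.1 ≠ [] ∧ x = mergeM y k) ∨ ∃ k ≤ y.1.length, x = insertM y k

/-- `mprec x y` is the relation `x ⪯ y` on marked compositions. -/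
def mprec (x y : MComp) : Prop := Relation.ReflTransGen mstep y x

/-- One merge or insert step on compositions: merges `M_j`, `1 ≤ j ≤ ℓ-1`
(0-indexed: positions `k, k+1` with `k + 2 ≤ ℓ`), and all inserts. -/
def cstep (y x : Comp) : Prop :=
  (∃ k, k + 2 ≤ y.length ∧ x = mergeAux y k) ∨ ∃ k ≤ y.length, x = insertC y k

/-- `cprec x y` is the relation `x ⪯ y` on compositions. -/
def cprec (x y : Comp) : Prop := Relation.ReflTransGen cstep y x

/-- The value of the merge differential `∂_M^∞` on a basis element (it is `0` when `ℓ = 0`). -/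
noncomputable def dMval (x : MComp) : MComp →₀ ℤ :=
  if x.1.length = 0 then 0
  else -∑ k ∈ Finset.range (x.1.length + 1), Finsupp.single (mergeM x k) ((-1 : ℤ) ^ k)

/-- The value of the insert differential `∂_I^∞` on a basis element. -/
noncomputable def dIval (x : MComp) : MComp →₀ ℤ :=
  ∑ k ∈ Finset.range (x.1.length + 1), Finsupp.single (insertM x k) ((-1 : ℤ) ^ k)

/-- The merge differential `∂_M^∞` on `ℤ[Ω^∞]`. -/
noncomputable def dM : (MComp →₀ ℤ) →ₗ[ℤ] (MComp →₀ ℤ) :=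
  Finsupp.lsum ℤ fun x => LinearMap.toSpanSingleton ℤ (MComp →₀ ℤ) (dMval x)

/-- The insert differential `∂_I^∞` on `ℤ[Ω^∞]`. -/
noncomputable def dI : (MComp →₀ ℤ) →ₗ[ℤ] (MComp →₀ ℤ) :=
  Finsupp.lsum ℤ fun x => LinearMap.toSpanSingleton ℤ (MComp →₀ ℤ) (dIval x)

/-- The truncated differential `∂^∞` at level `m`: `∂_M^∞ x + ∂_I^∞ x` when `|x| < m`
(indeed whenever `|x| ≠ m`) and `∂_M^∞ x` when `|x| = m`. -/
noncomputable def dInf (m : ℕ) : (MComp →₀ ℤ) →ₗ[ℤ] (MComp →₀ ℤ) :=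
  Finsupp.lsum ℤ fun x => LinearMap.toSpanSingleton ℤ (MComp →₀ ℤ)
    (if normM x = m then dMval x else dMval x + dIval x)

/-- The truncation map at level `d`: basis elements of norm `≤ d` are kept, all
other basis elements are sent to `0`. -/
noncomputable def truncM (d : ℕ) : (MComp →₀ ℤ) →ₗ[ℤ] (MComp →₀ ℤ) :=
  Finsupp.lsum ℤ fun x => LinearMap.toSpanSingleton ℤ (MComp →₀ ℤ)
    (if normM x ≤ d then Finsupp.single x 1 else 0)

/-- The cells of `ℤ[Θ_{⟨m]}]` of degree `j` (a basis element `x` has degree `m - |x|'`). -/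
def cellLe (Θ : Set MComp) (m : ℕ) (j : ℤ) : Set MComp :=
  {x | x ∈ Θ ∧ normM x ≤ m ∧ (m : ℤ) - (rnormM x : ℤ) = j}

/-- The cells of `ℤ[Θ_m]` of degree `j`. -/
def cellEq (Θ : Set MComp) (m : ℕ) (j : ℤ) : Set MComp :=
  {x | x ∈ Θ ∧ normM x = m ∧ (m : ℤ) - (rnormM x : ℤ) = j}

/-- Degree-`j` cycles of the complex `(ℤ[Θ_{⟨m]}], ∂^∞)`. -/
noncomputable def cyclesLe (Θ : Set MComp) (m : ℕ) (j : ℤ) : Submodule ℤ (MComp →₀ ℤ) :=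
  Finsupp.supported ℤ ℤ (cellLe Θ m j) ⊓ LinearMap.ker (dInf m)

/-- Degree-`j` boundaries of the complex `(ℤ[Θ_{⟨m]}], ∂^∞)`: the image under `∂^∞`
of the degree-`(j+1)` chain component. -/
noncomputable def bdriesLe (Θ : Set MComp) (m : ℕ) (j : ℤ) : Submodule ℤ (MComp →₀ ℤ) :=
  Submodule.map (dInf m) (Finsupp.supported ℤ ℤ (cellLe Θ m (j + 1)))

/-- Degree-`j` homology of `(ℤ[Θ_{⟨m]}], ∂^∞)`: cycles modulo boundaries. -/
noncomputable abbrev homologyLe (Θ : Set MComp) (m : ℕ) (j : ℤ) :=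
  cyclesLe Θ m j ⧸ Submodule.comap (cyclesLe Θ m j).subtype (bdriesLe Θ m j)

/-- Degree-`j` cycles of the complex `(ℤ[Θ_m], ∂_M^∞)`. -/
noncomputable def cyclesEq (Θ : Set MComp) (m : ℕ) (j : ℤ) : Submodule ℤ (MComp →₀ ℤ) :=
  Finsupp.supported ℤ ℤ (cellEq Θ m j) ⊓ LinearMap.ker dM

/-- Degree-`j` boundaries of the complex `(ℤ[Θ_m], ∂_M^∞)`. -/
noncomputable def bdriesEq (Θ : Set MComp) (m : ℕ) (j : ℤ) : Submodule ℤ (MComp →₀ ℤ) :=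
  Submodule.map dM (Finsupp.supported ℤ ℤ (cellEq Θ m (j + 1)))

section Helpers

open Finset

lemma insertC_zero (ω : Comp) : insertC ω 0 = 2 :: ω := by simp [insertC]

lemma insertC_cons (a : PNat) (t : Comp) (j : ℕ) :
    insertC (a :: t) (j + 1) = a :: insertC t j := by simp [insertC]

lemma length_insertC (ω : Comp) (k : ℕ) : (insertC ω k).length = ω.length + 1 := by
  have := congrArg List.length (List.take_append_drop k ω)
  simp only [insertC, List.length_append, List.length_cons] at *
  omega

lemma normC_cons (a : PNat) (t : Comp) : normC (a :: t) = a + normC t := by simp [normC]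

lemma normC_insertC (ω : Comp) (k : ℕ) : normC (insertC ω k) = normC ω + 2 := by
  have h2 : ((2 : PNat) : ℕ) = 2 := rfl
  induction ω generalizing k with
  | nil => simp [insertC, normC_cons, h2, add_comm]
  | cons a t ih =>
    cases k with
    | zero => rw [insertC_zero, normC_cons, h2, add_comm]
    | succ k => rw [insertC_cons, normC_cons, ih, normC_cons, add_assoc]

lemma length_le_normC (ω : Comp) : ω.length ≤ normC ω := by
  induction ω with
  | nil => simp
  | cons a t ih =>
    have := a.pos
    simp only [normC_cons, List.length_cons]
    omega

lemma normC_mergeAux (ω : Comp) (k : ℕ) : normC (mergeAux ω k) = normC ω := by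
  induction ω generalizing k with
  | nil => simp [mergeAux]
  | cons a t ih =>
    cases k with
    | zero =>
      cases t with
      | nil => simp [mergeAux]
      | cons b t => simp [mergeAux, normC_cons, add_assoc]
    | succ k => simp [mergeAux, normC_cons, ih]

lemma length_mergeAux (ω : Comp) (k : ℕ) (h : k + 2 ≤ ω.length) :
    (mergeAux ω k).length + 1 = ω.length := by
  induction ω generalizing k with
  | nil => simp at h
  | cons a t ih =>
    cases k with
    | zero =>
      cases t with
      | nil => simp at h
      | cons b t => simp [mergeAux]
    | succ k =>
      simp only [List.length_cons] at h
      simp [mergeAux, ih k (by omega)]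

lemma normM_insertM (x : MComp) (k : ℕ) : normM (insertM x k) = normM x + 2 := by
  simp only [normM, insertM, normC_insertC]; omega

lemma normM_mergeM (x : MComp) (k : ℕ) : normM (mergeM x k) = normM x := by
  obtain ⟨ω, κ⟩ := x
  unfold mergeM
  split_ifs with h0 h1
  · cases ω with
    | nil => rfl
    | cons a t => simp only [normM, normC_cons]; omega
  · rcases List.eq_nil_or_concat ω with rfl | ⟨l, a, rfl⟩
    · rfl
    · simp [normM, normC]; omega
  · simp [normM, normC_mergeAux]

lemma length_mergeM (x : MComp) (k : ℕ) (hk : k ≤ x.1.length) (hx : x.1 ≠ []) :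
    (mergeM x k).1.length + 1 = x.1.length := by
  obtain ⟨ω, κ⟩ := x
  unfold mergeM
  split_ifs with h0 h1
  · cases ω with
    | nil => simp at hx
    | cons a t => simp
  · rcases List.eq_nil_or_concat ω with rfl | ⟨l, a, rfl⟩
    · simp at hx
    · simp
  · apply length_mergeAux
    simp only at *
    omega

lemma rnormM_eq (x : MComp) : rnormM x + x.1.length = normM x := by
  have := length_le_normC x.1
  simp only [rnormM, rnormC, normM]; omega

/-! combinatorial identities -/

lemma insertC_insertC (ω : Comp) (i j : ℕ) (hij : i ≤ j) (hj : j ≤ ω.length) :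
    insertC (insertC ω j) i = insertC (insertC ω i) (j + 1) := by
  induction ω generalizing i j with
  | nil =>
    simp only [List.length_nil, Nat.le_zero] at hj
    subst hj
    obtain rfl : i = 0 := by omega
    simp [insertC]
  | cons a t ih =>
    cases i with
    | zero => simp [insertC_zero, insertC_cons]
    | succ i =>
      cases j with
      | zero => omega
      | succ j =>
        simp only [List.length_cons] at hj
        simp [insertC_cons, ih i j (by omega) (by omega)]

lemma merge_insert_lt (ω : Comp) (k j : ℕ) (hk : k < j) (hj : j + 1 ≤ ω.length) :
    mergeAux (insertC ω (j + 1)) k = insertC (mergeAux ω k) j := by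
  induction ω generalizing k j with
  | nil => simp at hj
  | cons a t ih =>
    cases j with
    | zero => omega
    | succ j =>
      simp only [List.length_cons] at hj
      cases k with
      | zero =>
        cases t with
        | nil => simp at hj
        | cons b t => simp [insertC_cons, mergeAux]
      | succ k =>
        rw [insertC_cons]
        simp [mergeAux, insertC_cons, ih k j (by omega) (by omega)]

lemma merge_insert_gt (ω : Comp) (k j : ℕ) (hk : j ≤ k) (hj : k + 2 ≤ ω.length) :
    mergeAux (insertC ω j) (k + 1) = insertC (mergeAux ω k) j := by
  induction ω generalizing k j with
  | nil => simp at hj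
  | cons a t ih =>
    simp only [List.length_cons] at hj
    cases j with
    | zero => simp [insertC_zero, mergeAux]
    | succ j =>
      cases k with
      | zero => omega
      | succ k =>
        rw [insertC_cons]
        simp [mergeAux, insertC_cons, ih k j (by omega) (by omega)]

lemma merge_insert_mid (ω : Comp) (j : ℕ) (hj : j < ω.length) :
    mergeAux (insertC ω j) j = mergeAux (insertC ω (j + 1)) j := by
  induction ω generalizing j with
  | nil => simp at hj
  | cons a t ih =>
    simp only [List.length_cons] at hj
    cases j with
    | zero => simp [insertC_zero, insertC_cons, mergeAux, add_comm]
    | succ j => simp [insertC_cons, mergeAux, ih j (by omega)]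

lemma insertC_append (l r : Comp) (j : ℕ) (hj : j ≤ l.length) :
    insertC (l ++ r) j = insertC l j ++ r := by
  simp [insertC, List.take_append_of_le_length hj, List.drop_append_of_le_length hj]

lemma insertC_length (l : Comp) : insertC l l.length = l ++ [2] := by
  simp [insertC]

lemma mergeM_zero (a : PNat) (t : Comp) (κ : ℕ) : mergeM (a :: t, κ) 0 = (t, κ + a) := by
  simp [mergeM]

lemma mergeM_last (l : Comp) (a : PNat) (κ : ℕ) :
    mergeM (l ++ [a], κ) (l.length + 1) = (l, κ + a) := by
  simp [mergeM]

lemma mergeM_mid (ω : Comp) (κ k : ℕ) (h : k + 1 ≠ ω.length) :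
    mergeM (ω, κ) (k + 1) = (mergeAux ω k, κ) := by
  simp [mergeM, h]

lemma mergeM_insertM_lt (x : MComp) (k j : ℕ) (hk : k < j + 1) (hj : j + 1 ≤ x.1.length) :
    mergeM (insertM x (j + 1)) k = insertM (mergeM x k) j := by
  obtain ⟨ω, κ⟩ := x
  simp only [insertM] at *
  cases k with
  | zero =>
    cases ω with
    | nil => simp at hj
    | cons a t => rw [insertC_cons, mergeM_zero, mergeM_zero]
  | succ k =>
    rw [mergeM_mid _ _ _ (by rw [length_insertC]; omega), mergeM_mid _ _ _ (by omega),
      merge_insert_lt _ _ _ (by omega) hj]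

lemma mergeM_insertM_gt (x : MComp) (k j : ℕ) (hk : j + 1 ≤ k) (hj : k ≤ x.1.length) :
    mergeM (insertM x j) (k + 1) = insertM (mergeM x k) j := by
  obtain ⟨ω, κ⟩ := x
  simp only [insertM] at *
  rcases hj.eq_or_lt with h | h
  · rcases List.eq_nil_or_concat ω with rfl | ⟨l, a, rfl⟩
    · simp at h; omega
    · simp only [List.concat_eq_append, List.length_append, List.length_cons,
        List.length_nil, zero_add] at *
      subst h
      rw [insertC_append _ _ _ (by omega), mergeM_last]
      have := mergeM_last (insertC l j) a κ
      rw [length_insertC] at this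
      rw [this]
  · cases k with
    | zero => omega
    | succ k =>
      rw [mergeM_mid _ _ _ (by rw [length_insertC]; omega), mergeM_mid _ _ _ (by omega),
        merge_insert_gt _ _ _ (by omega) (by omega)]

lemma mergeM_insertM_mid (x : MComp) (j : ℕ) (hj : j < x.1.length) :
    mergeM (insertM x j) (j + 1) = mergeM (insertM x (j + 1)) (j + 1) := by
  obtain ⟨ω, κ⟩ := x
  simp only [insertM] at *
  rw [mergeM_mid _ _ _ (by rw [length_insertC]; omega),
    mergeM_mid _ _ _ (by rw [length_insertC]; omega), merge_insert_mid _ _ hj]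

lemma mergeM_insertM_ends (x : MComp) :
    mergeM (insertM x 0) 0 = mergeM (insertM x x.1.length) (x.1.length + 1) := by
  obtain ⟨ω, κ⟩ := x
  simp only [insertM]
  rw [insertC_zero, insertC_length, mergeM_zero, mergeM_last]

/-! alternating sums -/

lemma alt_sum_II {A : Type*} [AddCommGroup A] (F : ℕ → ℕ → A) (n : ℕ)
    (h : ∀ i j, i ≤ j → j ≤ n → F i j = F (j + 1) i) :
    ∑ j ∈ range (n + 1), ∑ i ∈ range (n + 2), ((-1 : ℤ) ^ j * (-1) ^ i) • F i j = 0 := by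
  induction n with
  | zero =>
    simp [sum_range_succ, h 0 0 le_rfl le_rfl]
  | succ n ih =>
    have ih := ih (fun i j hij hj => h i j hij (by omega))
    rw [sum_range_succ]
    have e1 : ∀ j, ∑ i ∈ range (n + 1 + 2), ((-1 : ℤ) ^ j * (-1) ^ i) • F i j
        = ∑ i ∈ range (n + 2), ((-1 : ℤ) ^ j * (-1) ^ i) • F i j
          + ((-1 : ℤ) ^ j * (-1) ^ (n + 2)) • F (n + 2) j := fun j => sum_range_succ _ _
    rw [sum_congr rfl (fun j _ => e1 j), sum_add_distrib, ih, e1, sum_range_succ _ (n + 1)]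
    have e2 : ∑ i ∈ range (n + 1), ((-1 : ℤ) ^ (n + 1) * (-1) ^ i) • F i (n + 1)
        = - ∑ j ∈ range (n + 1), ((-1 : ℤ) ^ j * (-1) ^ (n + 2)) • F (n + 2) j := by
      rw [← sum_neg_distrib]
      refine sum_congr rfl fun i hi => ?_
      rw [mem_range] at hi
      rw [h i (n + 1) (by omega) le_rfl, ← neg_smul]
      congr 1
      ring
    rw [e2, h (n + 1) (n + 1) le_rfl le_rfl]
    have e3 : ((-1 : ℤ) ^ (n + 1) * (-1) ^ (n + 2)) = -((-1 : ℤ) ^ (n + 1) * (-1) ^ (n + 1)) := by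
      ring
    rw [e3, neg_smul]
    abel

lemma alt_sum_MI {A : Type*} [AddCommGroup A] (G H : ℕ → ℕ → A) (n : ℕ)
    (hlt : ∀ k j, k < j + 1 → j + 1 ≤ n → G k (j + 1) = H j k)
    (hgt : ∀ k j, j + 1 ≤ k → k ≤ n → G (k + 1) j = H j k)
    (hmid : ∀ j, j < n → G (j + 1) j = G (j + 1) (j + 1))
    (hends : G 0 0 = G (n + 1) n) :
    ∑ j ∈ range (n + 1), ∑ k ∈ range (n + 2), ((-1 : ℤ) ^ j * (-1) ^ k) • G k j
     + ∑ k ∈ range (n + 1), ∑ i ∈ range n, ((-1 : ℤ) ^ k * (-1) ^ i) • H i k = 0 := by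
  let a : ℕ → A := fun j => ∑ k ∈ range j, ((-1 : ℤ) ^ j * (-1) ^ k) • G k j
  let b : ℕ → A := fun j => ∑ k ∈ Ico (j + 1) (n + 1), ((-1 : ℤ) ^ j * (-1) ^ (k + 1)) • G (k + 1) j
  let f : ℕ → A := fun j => if j = n + 1 then G (n + 1) n else G j j
  have hsplit : ∀ j ∈ range (n + 1),
      ∑ k ∈ range (n + 2), ((-1 : ℤ) ^ j * (-1) ^ k) • G k j = a j + b j + (f j - f (j + 1)) := by
    intro j hj
    rw [mem_range] at hj
    rw [← sum_range_add_sum_Ico _ (show j ≤ n + 2 by omega),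
      sum_eq_sum_Ico_succ_bot (show j < n + 2 by omega),
      sum_eq_sum_Ico_succ_bot (show j + 1 < n + 2 by omega)]
    have hb : ∑ k ∈ Ico (j + 1 + 1) (n + 2), ((-1 : ℤ) ^ j * (-1) ^ k) • G k j = b j := by
      simp only [b]
      rw [sum_Ico_add' (fun k => ((-1 : ℤ) ^ j * (-1) ^ k) • G k j) (j + 1) (n + 1) 1]
    rw [hb]
    have f1 : f j = G j j := by simp only [f]; rw [if_neg (by omega)]
    have f2 : f (j + 1) = G (j + 1) j := by
      simp only [f]
      split_ifs with h
      · obtain rfl : j = n := by omega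
        rfl
      · exact (hmid j (by omega)).symm
    have s : ((-1 : ℤ) ^ j * (-1) ^ j) = 1 := by
      rw [← mul_pow]; simp
    rw [f1, f2, pow_succ, ← mul_assoc, s]
    simp only [a, one_smul, one_mul, neg_smul]
    abel
  rw [sum_congr rfl hsplit, sum_add_distrib, sum_add_distrib, sum_range_sub',
    sum_range_succ' a, sum_range_succ b]
  have f0 : f 0 - f (n + 1) = 0 := by
    simp [f, hends]
  have a0 : a 0 = 0 := by simp [a]
  have bn : b n = 0 := by simp [b]
  rw [f0, a0, bn, add_zero, add_zero, add_zero, ← sum_add_distrib, sum_comm (s := range (n + 1)),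
    ← sum_add_distrib]
  refine sum_eq_zero fun i hi => ?_
  rw [mem_range] at hi
  rw [← sum_range_add_sum_Ico _ (show i + 1 ≤ n + 1 by omega)]
  have ha : a (i + 1) = - ∑ k ∈ range (i + 1), ((-1 : ℤ) ^ k * (-1) ^ i) • H i k := by
    simp only [a]
    rw [← sum_neg_distrib]
    refine sum_congr rfl fun k hk => ?_
    rw [mem_range] at hk
    rw [hlt k i hk (by omega), ← neg_smul]
    congr 1
    ring
  have hb : b i = - ∑ k ∈ Ico (i + 1) (n + 1), ((-1 : ℤ) ^ k * (-1) ^ i) • H i k := by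
    simp only [b]
    rw [← sum_neg_distrib]
    refine sum_congr rfl fun k hk => ?_
    rw [mem_Ico] at hk
    rw [hgt k i hk.1 (by omega), ← neg_smul]
    congr 1
    ring
  rw [ha, hb]
  abel

/-! the differentials on basis elements -/

lemma dM_single (x : MComp) (c : ℤ) : dM (Finsupp.single x c) = c • dMval x := by
  simp [dM]

lemma dI_single (x : MComp) (c : ℤ) : dI (Finsupp.single x c) = c • dIval x := by
  simp [dI]

lemma dInf_single (m : ℕ) (x : MComp) (c : ℤ) : dInf m (Finsupp.single x c) =
    c • (if normM x = m then dMval x else dMval x + dIval x) := by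
  simp [dInf]

lemma truncM_single (m : ℕ) (x : MComp) (c : ℤ) : truncM m (Finsupp.single x c) =
    if normM x ≤ m then Finsupp.single x c else 0 := by
  simp only [truncM, Finsupp.lsum_single, LinearMap.toSpanSingleton_apply]
  split_ifs <;> simp

lemma dI_dI (x : MComp) : dI (dIval x) = 0 := by
  rw [dIval, map_sum]
  have := alt_sum_II (fun i j => Finsupp.single (insertM (insertM x j) i) (1 : ℤ)) x.1.length
    (fun i j hij hj => by simp only [insertM]; rw [insertC_insertC _ _ _ hij hj])
  rw [← this]
  refine sum_congr rfl fun j _ => ?_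
  rw [dI_single, dIval]
  simp only [insertM, length_insertC, smul_sum]
  refine sum_congr rfl fun i _ => ?_
  simp

lemma dM_dI (x : MComp) : dM (dIval x) + dI (dMval x) = 0 := by
  have key := alt_sum_MI (fun k j => Finsupp.single (mergeM (insertM x j) k) (1 : ℤ))
    (fun i k => Finsupp.single (insertM (mergeM x k) i) (1 : ℤ)) x.1.length
    (fun k j h1 h2 => by simp only [mergeM_insertM_lt x k j h1 h2])
    (fun k j h1 h2 => by simp only [mergeM_insertM_gt x k j h1 h2])
    (fun j h => by simp only [mergeM_insertM_mid x j h])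
    (by simp only [mergeM_insertM_ends x])
  have e1 : dM (dIval x) = - ∑ j ∈ range (x.1.length + 1), ∑ k ∈ range (x.1.length + 2),
      ((-1 : ℤ) ^ j * (-1) ^ k) • Finsupp.single (mergeM (insertM x j) k) (1 : ℤ) := by
    rw [dIval, map_sum, ← sum_neg_distrib]
    refine sum_congr rfl fun j _ => ?_
    rw [dM_single, dMval]
    have hl : (insertM x j).1.length = x.1.length + 1 := length_insertC _ _
    rw [hl, if_neg (by omega), smul_neg, smul_sum]
    congr 1
    refine sum_congr rfl fun i _ => ?_
    simp
  have e2 : dI (dMval x) = - ∑ k ∈ range (x.1.length + 1), ∑ i ∈ range x.1.length,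
      ((-1 : ℤ) ^ k * (-1) ^ i) • Finsupp.single (insertM (mergeM x k) i) (1 : ℤ) := by
    rw [dMval]
    split_ifs with h0
    · simp [h0]
    · rw [map_neg, map_sum]
      congr 1
      refine sum_congr rfl fun k hk => ?_
      rw [mem_range] at hk
      rw [dI_single, dIval, length_mergeM x k (by omega) (by rintro h; simp [h] at h0), smul_sum]
      refine sum_congr rfl fun i _ => ?_
      simp
  rw [e1, e2, ← neg_add, key, neg_zero]

/-! supports -/

lemma dMval_mem (x : MComp) (S : Set MComp)
    (h : ∀ k ≤ x.1.length, x.1 ≠ [] → mergeM x k ∈ S) :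
    dMval x ∈ Finsupp.supported ℤ ℤ S := by
  rw [dMval]
  split_ifs with h0
  · exact Submodule.zero_mem _
  · refine Submodule.neg_mem _ (Submodule.sum_mem _ fun k hk => ?_)
    rw [mem_range] at hk
    exact Finsupp.single_mem_supported _ _ (h k (by omega) (by rintro h; simp [h] at h0))

lemma dIval_mem (x : MComp) (S : Set MComp)
    (h : ∀ k ≤ x.1.length, insertM x k ∈ S) :
    dIval x ∈ Finsupp.supported ℤ ℤ S := by
  rw [dIval]
  refine Submodule.sum_mem _ fun k hk => ?_
  rw [mem_range] at hk
  exact Finsupp.single_mem_supported _ _ (h k (by omega))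

lemma dMval_norm (x : MComp) : dMval x ∈ Finsupp.supported ℤ ℤ {y | normM y = normM x} :=
  dMval_mem _ _ fun k _ _ => normM_mergeM x k

lemma dIval_norm (x : MComp) : dIval x ∈ Finsupp.supported ℤ ℤ {y | normM y = normM x + 2} :=
  dIval_mem _ _ fun k _ => normM_insertM x k

lemma apply_zero_of_mem {S : Set MComp} {c : MComp →₀ ℤ} (h : c ∈ Finsupp.supported ℤ ℤ S)
    {x : MComp} (hx : x ∉ S) : c x = 0 := (Finsupp.mem_supported' ℤ c).1 h x hx

/-- Induction for supported elements against linear maps into submodules. -/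
lemma supported_map_mem {S : Set MComp} (f : (MComp →₀ ℤ) →ₗ[ℤ] (MComp →₀ ℤ))
    (P : Submodule ℤ (MComp →₀ ℤ)) (h : ∀ x ∈ S, f (Finsupp.single x 1) ∈ P)
    {c : MComp →₀ ℤ} (hc : c ∈ Finsupp.supported ℤ ℤ S) : f c ∈ P := by
  have : Finsupp.supported ℤ ℤ S ≤ P.comap f := by
    rw [Finsupp.supported_eq_span_single, Submodule.span_le]
    rintro _ ⟨x, hx, rfl⟩
    exact h x hx
  exact this hc

lemma supported_eq {S : Set MComp} (f g : (MComp →₀ ℤ) →ₗ[ℤ] (MComp →₀ ℤ))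
    (h : ∀ x ∈ S, f (Finsupp.single x 1) = g (Finsupp.single x 1))
    {c : MComp →₀ ℤ} (hc : c ∈ Finsupp.supported ℤ ℤ S) : f c = g c := by
  have := supported_map_mem (f - g) ⊥ (fun x hx => by simp [h x hx]) hc
  simpa [sub_eq_zero] using this

lemma dM_norm {m : ℕ} {c : MComp →₀ ℤ} (hc : c ∈ Finsupp.supported ℤ ℤ {x | normM x = m}) :
    dM c ∈ Finsupp.supported ℤ ℤ {x | normM x = m} := by
  refine supported_map_mem _ _ (fun x hx => ?_) hc
  rw [dM_single, one_smul]
  have hx : normM x = m := hx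
  subst hx
  exact dMval_norm x

lemma dInf_eq_dM {m : ℕ} {c : MComp →₀ ℤ} (hc : c ∈ Finsupp.supported ℤ ℤ {x | normM x = m}) :
    dInf m c = dM c := by
  refine supported_eq _ _ (fun x hx => ?_) hc
  have hx : normM x = m := hx
  rw [dM_single, dInf_single, if_pos hx]

lemma truncM_apply (m : ℕ) (c : MComp →₀ ℤ) (x : MComp) :
    truncM m c x = if normM x ≤ m then c x else 0 := by
  induction c using Finsupp.induction_linear with
  | zero => simp
  | add f g hf hg => rw [map_add, Finsupp.add_apply, hf, hg]; split_ifs <;> simp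
  | single y a =>
    rw [truncM_single]
    by_cases hxy : y = x
    · subst hxy; split_ifs <;> simp
    · split_ifs <;> simp [Finsupp.single_apply, hxy]

/-- At norm `m`, `dInf m` agrees with `dM + dI`. -/
lemma dInf_apply_top (m : ℕ) (c : MComp →₀ ℤ) (x : MComp) (hx : normM x = m) :
    dInf m c x = (dM c + dI c) x := by
  induction c using Finsupp.induction_linear with
  | zero => simp
  | add f g hf hg =>
    rw [map_add, Finsupp.add_apply, hf, hg]
    simp only [map_add, Finsupp.add_apply]; ring
  | single y a =>
    rw [dInf_single, dM_single, dI_single]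
    split_ifs with h
    · have : dIval y x = 0 := apply_zero_of_mem (dIval_norm y) (by
        simp only [Set.mem_ofPred_eq]; omega)
      simp [this]
    · simp

/-- The part of `d²` we need. -/
lemma dInf_sq_top (m : ℕ) {c : MComp →₀ ℤ} (hc : c ∈ Finsupp.supported ℤ ℤ {x | normM x < m})
    (x : MComp) (hx : normM x = m) : dInf m (dInf m c) x = 0 := by
  have := supported_map_mem (dInf m ∘ₗ dInf m) (LinearMap.ker (Finsupp.lapply x)) (fun y hy => ?_) hc
  · simpa using this
  · have hy : normM y < m := hy
    rw [LinearMap.mem_ker, LinearMap.comp_apply, Finsupp.lapply_apply, dInf_apply_top m _ x hx,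
      dInf_single, if_neg (by omega), one_smul]
    have e : dM (dMval y + dIval y) + dI (dMval y + dIval y) = dM (dMval y) := by
      rw [map_add, map_add, dI_dI, add_zero, add_assoc, dM_dI, add_zero]
    rw [e]
    exact apply_zero_of_mem (dM_norm (dMval_norm y)) (by simp only [Set.mem_ofPred_eq]; omega)

variable {Θ : Set MComp}

lemma cellLe_lt (d : ℕ) (j : ℤ) : cellLe Θ d j ⊆ {x | normM x < d + 2} := fun x hx => by
  have := hx.2.1
  simp only [Set.mem_ofPred_eq]; omega

lemma cellEq_top (m : ℕ) (j : ℤ) : cellEq Θ m j ⊆ {x | normM x = m} := fun _ hx => hx.2.1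

lemma cellEq_le (m : ℕ) (j : ℤ) : cellEq Θ m j ⊆ cellLe Θ m j :=
  fun _ hx => ⟨hx.1, hx.2.1.le, hx.2.2⟩

lemma cellLe_lift (d : ℕ) (j : ℤ) : cellLe Θ d j ⊆ cellLe Θ (d + 2) (j + 2) := fun x hx => by
  refine ⟨hx.1, by have := hx.2.1; omega, ?_⟩
  have := hx.2.2
  push_cast; omega

lemma dInf_mem (hcl : ∀ y ∈ Θ, ∀ x : MComp, mprec x y → x ∈ Θ) (m : ℕ)
    (hd : ∀ x ∈ Θ, normM x % 2 = m % 2) (j : ℤ) {c : MComp →₀ ℤ}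
    (hc : c ∈ Finsupp.supported ℤ ℤ (cellLe Θ m (j + 1))) :
    dInf m c ∈ Finsupp.supported ℤ ℤ (cellLe Θ m j) := by
  refine supported_map_mem _ _ (fun x hx => ?_) hc
  obtain ⟨h1, h2, h3⟩ := hx
  have hM : dMval x ∈ Finsupp.supported ℤ ℤ (cellLe Θ m j) := by
    refine dMval_mem _ _ fun k hk hne => ⟨?_, ?_, ?_⟩
    · exact hcl x h1 _ (Relation.ReflTransGen.single (Or.inl ⟨k, hk, hne, rfl⟩))
    · rw [normM_mergeM]; exact h2
    · have e1 := rnormM_eq x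
      have e2 := rnormM_eq (mergeM x k)
      rw [normM_mergeM] at e2
      have e3 := length_mergeM x k hk hne
      omega
  rw [dInf_single, one_smul]
  split_ifs with h
  · exact hM
  · refine Submodule.add_mem _ hM (dIval_mem _ _ fun k hk => ⟨?_, ?_, ?_⟩)
    · exact hcl x h1 _ (Relation.ReflTransGen.single (Or.inr ⟨k, hk, rfl⟩))
    · rw [normM_insertM]
      have := hd x h1
      omega
    · have e1 := rnormM_eq x
      have e2 := rnormM_eq (insertM x k)
      rw [normM_insertM] at e2
      have e3 : (insertM x k).1.length = x.1.length + 1 := length_insertC _ _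
      omega

lemma truncM_mem (d : ℕ) (j : ℤ) {c : MComp →₀ ℤ}
    (hc : c ∈ Finsupp.supported ℤ ℤ (cellLe Θ (d + 2) (j + 2))) :
    truncM d c ∈ Finsupp.supported ℤ ℤ (cellLe Θ d j) := by
  refine supported_map_mem _ _ (fun x hx => ?_) hc
  rw [truncM_single]
  split_ifs with h
  · refine Finsupp.single_mem_supported _ _ ⟨hx.1, h, ?_⟩
    have := hx.2.2
    push_cast at this; omega
  · exact Submodule.zero_mem _

lemma truncM_of_le (d : ℕ) {c : MComp →₀ ℤ}
    (hc : c ∈ Finsupp.supported ℤ ℤ {x | normM x ≤ d}) : truncM d c = c := by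
  ext x
  rw [truncM_apply]
  split_ifs with h
  · rfl
  · exact (apply_zero_of_mem hc h).symm

lemma truncM_of_gt (d : ℕ) {c : MComp →₀ ℤ}
    (hc : c ∈ Finsupp.supported ℤ ℤ {x | normM x = d + 2}) : truncM d c = 0 := by
  ext x
  rw [truncM_apply]
  split_ifs with h
  · exact apply_zero_of_mem hc (by simp only [Set.mem_ofPred_eq]; omega)
  · rfl

lemma trunc_comm (d : ℕ) (hd : ∀ x ∈ Θ, normM x % 2 = d % 2) (j : ℤ) {c : MComp →₀ ℤ}
    (hc : c ∈ Finsupp.supported ℤ ℤ (cellLe Θ (d + 2) j)) :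
    truncM d (dInf (d + 2) c) = dInf d (truncM d c) := by
  refine supported_eq (truncM d ∘ₗ dInf (d + 2)) (dInf d ∘ₗ truncM d) (fun x hx => ?_) hc
  obtain ⟨h1, h2, -⟩ := hx
  have hp := hd x h1
  simp only [LinearMap.comp_apply, dInf_single, truncM_single, one_smul]
  have hM : normM x ≤ d → truncM d (dMval x) = dMval x := fun h =>
    truncM_of_le d (Finsupp.supported_mono (fun y hy => by
      simp only [Set.mem_ofPred_eq] at *; omega) (dMval_norm x))
  by_cases ht : normM x = d + 2
  · rw [if_pos ht, if_neg (by omega), map_zero]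
    exact truncM_of_gt d (by rw [← ht]; exact dMval_norm x)
  · rw [if_neg ht, if_pos (by omega), dInf_single, one_smul, map_add, hM (by omega)]
    split_ifs with h
    · rw [truncM_of_gt d (by rw [← h]; exact dIval_norm x), add_zero]
    · rw [truncM_of_le d (Finsupp.supported_mono (fun y hy => by
        simp only [Set.mem_ofPred_eq] at *; omega) (dIval_norm x))]

/-- Elements killed by truncation live on the top layer. -/
lemma mem_top_of_trunc (d : ℕ) (hd : ∀ x ∈ Θ, normM x % 2 = d % 2) (j : ℤ) {c : MComp →₀ ℤ}
    (hc : c ∈ Finsupp.supported ℤ ℤ (cellLe Θ (d + 2) j)) (h0 : truncM d c = 0) :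
    c ∈ Finsupp.supported ℤ ℤ (cellEq Θ (d + 2) j) := by
  rw [Finsupp.mem_supported']
  intro x hx
  by_cases h : x ∈ cellLe Θ (d + 2) j
  · have hp := hd x h.1
    have h2 := h.2.1
    have hne : normM x ≠ d + 2 := fun e => hx ⟨h.1, e, h.2.2⟩
    have := truncM_apply d c x
    rw [h0, if_pos (by omega)] at this
    exact this.symm
  · exact apply_zero_of_mem hc h

/-- The cycle condition for a top-layer element whose differential is minus that of a boundary. -/
lemma dM_zero_of (d : ℕ) (j i : ℤ) {z y : MComp →₀ ℤ}
    (hz : z ∈ Finsupp.supported ℤ ℤ (cellEq Θ (d + 2) j))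
    (hy : y ∈ Finsupp.supported ℤ ℤ (cellLe Θ d i))
    (h : dInf (d + 2) z = dInf (d + 2) (dInf (d + 2) y)) : dM z = 0 := by
  have hz' := Finsupp.supported_mono (cellEq_top (d + 2) j) hz
  ext x
  by_cases hx : normM x = d + 2
  · rw [← dInf_eq_dM hz', h]
    exact dInf_sq_top _ (Finsupp.supported_mono (cellLe_lt d i) hy) x hx
  · exact apply_zero_of_mem (dM_norm hz') hx

end Helpers

/-- If the complex `(ℤ[Θ_{d+2}], ∂_M^∞)` has vanishing homology in all
degrees `≥ k`, then for every `j > k` the truncation induces an isomorphism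
`H_{j+2}(ℤ[Θ_{⟨d+2]}], ∂^∞) ≅ H_j(ℤ[Θ_{⟨d]}], ∂^∞)`. -/
theorem trunc_homology_iso_of_acyclic (Θ : Set MComp)
    (hcl : ∀ y ∈ Θ, ∀ x : MComp, mprec x y → x ∈ Θ)
    (hpar : ∀ x ∈ Θ, ∀ y ∈ Θ, normM x % 2 = normM y % 2)
    (d : ℕ) (hd : ∀ x ∈ Θ, normM x % 2 = d % 2)
    (k : ℤ)
    (hacyc : ∀ j : ℤ, k ≤ j → cyclesEq Θ (d + 2) j ≤ bdriesEq Θ (d + 2) j) :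
    ∀ j : ℤ, k < j →
      ∃ e : homologyLe Θ (d + 2) (j + 2) ≃ₗ[ℤ] homologyLe Θ d j,
        ∀ (v : cyclesLe Θ (d + 2) (j + 2)) (w : cyclesLe Θ d j),
          (w : MComp →₀ ℤ) = truncM d (v : MComp →₀ ℤ) →
          e (Submodule.Quotient.mk v) = Submodule.Quotient.mk w := by
  intro j hj
  have hd2 : ∀ x ∈ Θ, normM x % 2 = (d + 2) % 2 := fun x hx => by rw [hd x hx]; omega
  have hfmem : ∀ v ∈ cyclesLe Θ (d + 2) (j + 2), truncM d v ∈ cyclesLe Θ d j := by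
    rintro v ⟨h1, h2⟩
    refine ⟨truncM_mem d j h1, ?_⟩
    have h2 : dInf (d + 2) v = 0 := h2
    change dInf d (truncM d v) = 0
    rw [← trunc_comm d hd _ h1, h2, map_zero]
  let f : cyclesLe Θ (d + 2) (j + 2) →ₗ[ℤ] cyclesLe Θ d j := (truncM d).restrict hfmem
  have hle : Submodule.comap (cyclesLe Θ (d + 2) (j + 2)).subtype (bdriesLe Θ (d + 2) (j + 2)) ≤
      (Submodule.comap (cyclesLe Θ d j).subtype (bdriesLe Θ d j)).comap f := by
    rintro ⟨v, hv⟩ ⟨y, hy, hyv⟩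
    have hyv : dInf (d + 2) y = v := hyv
    rw [show j + 2 + 1 = j + 1 + 2 by ring] at hy
    refine ⟨truncM d y, truncM_mem d (j + 1) hy, ?_⟩
    change dInf d (truncM d y) = truncM d v
    rw [← trunc_comm d hd _ hy, hyv]
  let g : homologyLe Θ (d + 2) (j + 2) →ₗ[ℤ] homologyLe Θ d j := Submodule.mapQ _ _ f hle
  have hg : ∀ v, g (Submodule.Quotient.mk v) = Submodule.Quotient.mk (f v) := fun v => rfl
  have hinj : Function.Injective g := by
    rw [injective_iff_map_eq_zero]
    intro q hq
    obtain ⟨⟨v, hv⟩, rfl⟩ := Submodule.Quotient.mk_surjective _ q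
    rw [hg, Submodule.Quotient.mk_eq_zero] at hq
    rw [Submodule.Quotient.mk_eq_zero]
    obtain ⟨y, hy, hyv⟩ := hq
    have hyv : dInf d y = truncM d v := hyv
    have hy2 : y ∈ Finsupp.supported ℤ ℤ (cellLe Θ (d + 2) (j + 2 + 1)) := by
      rw [show j + 2 + 1 = j + 1 + 2 by ring]
      exact Finsupp.supported_mono (cellLe_lift d (j + 1)) hy
    have hty : truncM d y = y := truncM_of_le d (Finsupp.supported_mono (fun x hx => hx.2.1) hy)
    have hDy := dInf_mem hcl (d + 2) hd2 (j + 2) hy2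
    have hz : dInf (d + 2) y - v ∈ Finsupp.supported ℤ ℤ (cellEq Θ (d + 2) (j + 2)) := by
      refine mem_top_of_trunc d hd _ (Submodule.sub_mem _ hDy hv.1) ?_
      rw [map_sub, trunc_comm d hd _ hy2, hty, hyv, sub_self]
    have hv2 : dInf (d + 2) v = 0 := hv.2
    have hcyc : dM (dInf (d + 2) y - v) = 0 :=
      dM_zero_of d _ _ hz hy (by rw [map_sub, hv2, sub_zero])
    obtain ⟨u, hu, huz⟩ := hacyc (j + 2) (by omega) ⟨hz, hcyc⟩
    refine ⟨y - u, Submodule.sub_mem _ hy2 (Finsupp.supported_mono (cellEq_le _ _) hu), ?_⟩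
    change dInf (d + 2) (y - u) = v
    rw [map_sub, dInf_eq_dM (Finsupp.supported_mono (cellEq_top _ _) hu), huz]
    abel
  have hsurj : Function.Surjective g := by
    intro q
    obtain ⟨⟨w, hw⟩, rfl⟩ := Submodule.Quotient.mk_surjective _ q
    have hw1 : w ∈ Finsupp.supported ℤ ℤ (cellLe Θ d j) := hw.1
    have hw0 : dInf d w = 0 := hw.2
    have hw2 : w ∈ Finsupp.supported ℤ ℤ (cellLe Θ (d + 2) (j + 1 + 1)) := by
      rw [show j + 1 + 1 = j + 2 by ring]
      exact Finsupp.supported_mono (cellLe_lift d j) hw1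
    have htw : truncM d w = w := truncM_of_le d (Finsupp.supported_mono (fun x hx => hx.2.1) hw1)
    have hz : dInf (d + 2) w ∈ Finsupp.supported ℤ ℤ (cellEq Θ (d + 2) (j + 1)) := by
      refine mem_top_of_trunc d hd _ (dInf_mem hcl (d + 2) hd2 (j + 1) hw2) ?_
      rw [trunc_comm d hd _ hw2, htw, hw0]
    have hcyc : dM (dInf (d + 2) w) = 0 := dM_zero_of d _ _ hz hw1 rfl
    obtain ⟨u, hu, huz⟩ := hacyc (j + 1) (by omega) ⟨hz, hcyc⟩
    have hut := Finsupp.supported_mono (cellEq_top _ _) hu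
    have hv : w - u ∈ cyclesLe Θ (d + 2) (j + 2) := by
      refine ⟨?_, ?_⟩
      · rw [show j + 2 = j + 1 + 1 by ring]
        exact Submodule.sub_mem _ hw2 (Finsupp.supported_mono (cellEq_le _ _) hu)
      · change dInf (d + 2) (w - u) = 0
        rw [map_sub, dInf_eq_dM hut, huz, sub_self]
    refine ⟨Submodule.Quotient.mk ⟨w - u, hv⟩, ?_⟩
    rw [hg]
    congr 1
    apply Subtype.ext
    change truncM d (w - u) = w
    rw [map_sub, htw, truncM_of_gt d hut, sub_zero]
  refine ⟨LinearEquiv.ofBijective g ⟨hinj, hsurj⟩, fun v w hwv => ?_⟩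
  change g (Submodule.Quotient.mk v) = _
  rw [hg]
  congr 1
  exact Subtype.ext hwv.symm
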